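/- arXiv:1806.00652 — 4 statements merged into one kernel-verified Lean document; each statement's English description precedes it below -/
import Mathlib

section
/- Assume (f) and (D1) with threshold α ∈ (0,1), and let ℓ⁻ ∈ [0,α) and ℓ⁺ ∈ (α,1]. If the equation ρ_t + f(ρ)_x = (D(ρ)ρ_x)_x admits a wavefront solution from ℓ⁻ to ℓ⁺ with profile φ and speed c, then c = (f(α) − f(ℓ⁻))/(α − ℓ⁻) = (f(ℓ⁺) − f(α))/(ℓ⁺ − α), and moreover f(ρ) > f(α) + c(ρ − α) for every ρ ∈ (ℓ⁻, α) and f(ρ) < f(α) + c(ρ − α) for every ρ ∈ (α, ℓ⁺). -/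
open Set Filter MeasureTheory Topology

/-- A traveling-wave profile of `ρ_t + f(ρ)_x = (D(ρ)ρ_x)_x` with speed `c`:
a continuous `φ : ℝ → [0,1]`, differentiable off a countable set, with
`D(φ)φ'` locally integrable, satisfying the weak form of the profile ODE. -/
def IsTWProfile (f D : ℝ → ℝ) (c : ℝ) (φ : ℝ → ℝ) : Prop :=
  Continuous φ ∧ (∀ ξ, φ ξ ∈ Icc (0:ℝ) 1) ∧
  (∃ S : Set ℝ, S.Countable ∧ ∀ ξ ∉ S, DifferentiableAt ℝ φ ξ) ∧
  LocallyIntegrable (fun ξ => D (φ ξ) * deriv φ ξ) ∧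
  ∀ ψ : ℝ → ℝ, ContDiff ℝ (⊤ : ℕ∞) ψ → HasCompactSupport ψ →
    ∫ ξ, (D (φ ξ) * deriv φ ξ - f (φ ξ) + c * φ ξ) * deriv ψ ξ = 0

/-- A wavefront from `ℓm` to `ℓp`: a monotone, non-constant traveling-wave
profile with limits `ℓm` at `-∞` and `ℓp` at `+∞`. -/
def IsWavefront (f D : ℝ → ℝ) (c ℓm ℓp : ℝ) (φ : ℝ → ℝ) : Prop :=
  IsTWProfile f D c φ ∧ (Monotone φ ∨ Antitone φ) ∧ (∃ x y, φ x ≠ φ y) ∧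
  Tendsto φ atBot (𝓝 ℓm) ∧ Tendsto φ atTop (𝓝 ℓp)

lemma aux_primitive (η : ℝ → ℝ) (hη : ContDiff ℝ (⊤ : ℕ∞) η) (hc : HasCompactSupport η)
    (h0 : ∫ x, η x = 0) :
    ∃ ψ : ℝ → ℝ, ContDiff ℝ (⊤ : ℕ∞) ψ ∧ HasCompactSupport ψ ∧ deriv ψ = η := by
  obtain ⟨R, hR⟩ := hc.isCompact.isBounded.subset_closedBall 0
  have hz : ∀ x, x ∉ Icc (-R) R → η x = 0 := by
    intro x hx
    by_contra h
    have := hR (subset_tsupport _ h)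
    rw [Real.closedBall_eq_Icc] at this
    simp only [zero_sub, zero_add] at this
    exact hx this
  have hd : ∀ x, HasDerivAt (fun x => ∫ t in (-R)..x, η t) (η x) x := fun x =>
    hη.continuous.integral_hasStrictDerivAt (-R) x |>.hasDerivAt
  have hde : deriv (fun x => ∫ t in (-R)..x, η t) = η := funext fun x => (hd x).deriv
  refine ⟨fun x => ∫ t in (-R)..x, η t, ?_, ?_, hde⟩
  · rw [contDiff_infty_iff_deriv]
    exact ⟨fun x => (hd x).differentiableAt, by rw [hde]; exact hη⟩
  · apply HasCompactSupport.of_support_subset_isCompact (isCompact_Icc (a := -R) (b := R))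
    intro x hx
    by_contra hxn
    apply hx
    rw [mem_Icc, not_and_or, not_le, not_le] at hxn
    rcases hxn with hxn | hxn
    · show ∫ t in (-R)..x, η t = 0
      rw [intervalIntegral.integral_symm, neg_eq_zero]
      rw [intervalIntegral.integral_of_le hxn.le, integral_Ioc_eq_integral_Ioo]
      apply setIntegral_eq_zero_of_forall_eq_zero
      intro t ht
      exact hz t (fun h => absurd h.1 (not_le.2 ht.2))
    · show ∫ t in (-R)..x, η t = 0
      by_cases hRR : R < -R
      · have : η = fun _ => 0 := by
          funext t; exact hz t (fun h => by linarith [h.1, h.2])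
        simp [this]
      push Not at hRR
      rw [intervalIntegral.integral_of_le (hRR.trans hxn.le), ← integral_Icc_eq_integral_Ioc,
        ← h0]
      apply setIntegral_eq_integral_of_forall_compl_eq_zero
      intro t ht
      exact hz t (fun h => ht ⟨h.1, h.2.trans hxn.le⟩)

lemma aux_dubois (h : ℝ → ℝ) (hl : LocallyIntegrable h)
    (hw : ∀ ψ : ℝ → ℝ, ContDiff ℝ (⊤ : ℕ∞) ψ → HasCompactSupport ψ →
      ∫ ξ, h ξ * deriv ψ ξ = 0) : ∃ K : ℝ, ∀ᵐ x, h x = K := by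
  obtain ⟨θ0, hθs, hθc, hθ1⟩ : ∃ θ : ℝ → ℝ, ContDiff ℝ (⊤ : ℕ∞) θ ∧ HasCompactSupport θ ∧
      ∫ x, θ x = 1 := by
    let b : ContDiffBump (0:ℝ) := ⟨1, 2, by norm_num, by norm_num⟩
    exact ⟨b.normed volume, b.contDiff_normed, b.hasCompactSupport_normed, b.integral_normed⟩
  refine ⟨∫ x, θ0 x * h x, ?_⟩
  set K := ∫ x, θ0 x * h x with hK
  have key : ∀ᵐ x, h x - K = 0 := by
    apply ae_eq_zero_of_integral_contDiff_smul_eq_zero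
    · exact hl.sub (locallyIntegrable_const K)
    intro θ hθ hc
    have i1 : ∀ g : ℝ → ℝ, ContDiff ℝ (⊤ : ℕ∞) g → HasCompactSupport g →
        Integrable (fun x => g x * h x) := fun g hg hgc =>
      hl.integrable_smul_left_of_hasCompactSupport hg.continuous hgc
    have i2 : ∀ g : ℝ → ℝ, ContDiff ℝ (⊤ : ℕ∞) g → HasCompactSupport g →
        Integrable g := fun g hg hgc => hg.continuous.integrable_of_hasCompactSupport hgc
    obtain ⟨ψ, hψ, hψc, hψd⟩ := aux_primitive (fun x => θ x - (∫ y, θ y) * θ0 x)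
      (hθ.sub (contDiff_const.mul hθs)) (hc.sub hθc.mul_left) (by
        rw [integral_sub (i2 _ hθ hc) ((i2 _ hθs hθc).const_mul _), integral_const_mul, hθ1]
        ring)
    have := hw ψ hψ hψc
    rw [hψd] at this
    have e : ∀ x, h x * (θ x - (∫ y, θ y) * θ0 x) = θ x * h x - (∫ y, θ y) * (θ0 x * h x) :=
      fun x => by ring
    simp_rw [e] at this
    rw [integral_sub (i1 _ hθ hc) ((i1 _ hθs hθc).const_mul _), integral_const_mul] at this
    simp only [smul_eq_mul, mul_sub]
    rw [integral_sub (i1 _ hθ hc) ((i2 _ hθ hc).mul_const _), integral_mul_const]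
    exact this
  filter_upwards [key] with x hx
  linarith

lemma aux_lim_top (H H' : ℝ → ℝ) (L m : ℝ) (hd : ∀ x, HasDerivAt H (H' x) x) :
    (Tendsto H atTop (𝓝 L) → Tendsto H' atTop (𝓝 m) → m = 0) ∧
    (Tendsto H atBot (𝓝 L) → Tendsto H' atBot (𝓝 m) → m = 0) := by
  have : ∀ x : ℝ, ∃ y ∈ Ioo x (x+1), H' y = H (x+1) - H x := by
    intro x
    obtain ⟨y, hy, h⟩ := exists_hasDerivAt_eq_slope H H' (show x < x + 1 by linarith)
      (fun z _ => (hd z).continuousAt.continuousWithinAt) (fun z _ => hd z)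
    exact ⟨y, hy, by rw [h]; simp⟩
  choose y hy hyH using this
  constructor
  · intro h1 h2
    have a : Tendsto (fun x => H' (y x)) atTop (𝓝 m) :=
      h2.comp (tendsto_atTop_mono (fun x => (hy x).1.le) tendsto_id)
    have b : Tendsto (fun x => H' (y x)) atTop (𝓝 (L - L)) := by
      simp_rw [hyH]
      exact (h1.comp (tendsto_atTop_add_const_right _ 1 tendsto_id)).sub h1
    rw [sub_self] at b
    exact tendsto_nhds_unique a b
  · intro h1 h2
    have t : Tendsto (fun x : ℝ => x + 1) atBot atBot :=
      tendsto_atBot_add_const_right _ 1 tendsto_id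
    have a : Tendsto (fun x => H' (y x)) atBot (𝓝 m) :=
      h2.comp (tendsto_atBot_mono (fun x => (hy x).2.le) t)
    have b : Tendsto (fun x => H' (y x)) atBot (𝓝 (L - L)) := by
      simp_rw [hyH]
      exact (h1.comp t).sub h1
    rw [sub_self] at b
    exact tendsto_nhds_unique a b

/-- Core sign lemma: `A` primitive of `D > 0` on `[r, b]`, `(A ∘ φ)' = g ∘ φ`. -/
lemma aux_pos (φ g A D : ℝ → ℝ) (r b L ξ0 ξ1 : ℝ) (hrb : r < b)
    (hφ : Continuous φ) (hmono : Monotone φ)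
    (hA : ∀ u, HasDerivAt A (D u) u) (hDc : Continuous D)
    (hDpos : ∀ u ∈ Icc r b, 0 < D u)
    (hH : ∀ x, HasDerivAt (fun x => A (φ x)) (g (φ x)) x)
    (hL : ∀ u ∈ Icc r b, |g u - g r| ≤ L * |u - r|)
    (h0 : φ ξ0 = r) (h1 : φ ξ1 = b) : g r ≠ 0 := by
  intro hg
  have hlt : ξ0 < ξ1 := by
    by_contra h
    have := hmono (not_lt.1 h)
    linarith
  obtain ⟨u0, hu0, hmin⟩ := (isCompact_Icc (a := r) (b := b)).exists_isMinOn
    ⟨r, left_mem_Icc.2 hrb.le⟩ hDc.continuousOn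
  set δ := D u0
  have hδ : 0 < δ := hDpos u0 hu0
  have hL0 : 0 ≤ L := by
    have := hL b (right_mem_Icc.2 hrb.le)
    have h2 := (abs_nonneg _).trans this
    have h3 : 0 < |b - r| := abs_pos.2 (by linarith)
    by_contra hh
    nlinarith
  have hlow : ∀ u ∈ Icc r b, δ * (u - r) ≤ A u - A r := by
    intro u hu
    apply (convex_Icc r b).mul_sub_le_image_sub_of_le_deriv
      (fun z _ => (hA z).continuousAt.continuousWithinAt)
      (fun z _ => (hA z).differentiableAt.differentiableWithinAt) _ r
      (left_mem_Icc.2 hrb.le) u hu hu.1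
    intro z hz
    rw [(hA z).deriv]
    exact hmin (interior_subset hz)
  have hz := eq_zero_of_abs_deriv_le_mul_abs_self_of_eq_zero_right (K := L / δ)
    (f := fun x => A (φ x) - A r) (f' := fun x => g (φ x)) (a := ξ0) (b := ξ1)
    (fun z _ => ((hH z).sub_const _).continuousAt.continuousWithinAt)
    (fun z _ => ((hH z).sub_const _).hasDerivWithinAt) (by simp [h0]) (by
      intro x hx
      have hm : φ x ∈ Icc r b := ⟨h0 ▸ hmono hx.1, h1 ▸ hmono hx.2.le⟩
      have e1 := hL _ hm
      have e2 := hlow _ hm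
      rw [hg, sub_zero, abs_of_nonneg (sub_nonneg.2 hm.1)] at e1
      rw [Real.norm_eq_abs, Real.norm_eq_abs]
      have e3 : φ x - r ≤ |A (φ x) - A r| / δ := by
        rw [le_div_iff₀ hδ]
        calc _ = δ * (φ x - r) := by ring
          _ ≤ _ := e2.trans (le_abs_self _)
      calc _ ≤ L * (φ x - r) := e1
        _ ≤ L * (|A (φ x) - A r| / δ) := by gcongr
        _ = _ := by ring) ξ1 (right_mem_Icc.2 hlt.le)
  have e2 := hlow b (right_mem_Icc.2 hrb.le)
  simp only [h1] at hz
  nlinarith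

/-- Abstract form on extended functions. -/
lemma aux_ode (f D φ : ℝ → ℝ) (c : ℝ)
    (hf : ContinuousOn f (Icc 0 1)) (hD : ContinuousOn D (Icc 0 1))
    (hwf : IsTWProfile f D c φ) :
    ∃ (E A : ℝ → ℝ) (K : ℝ), Continuous E ∧ (∀ u ∈ Icc (0:ℝ) 1, E u = D u) ∧
      (∀ u, HasDerivAt A (E u) u) ∧
      ∀ x, HasDerivAt (fun x => A (φ x)) (f (φ x) - c * φ x + K) x := by
  obtain ⟨hφ, hφm, ⟨S, hS, hSd⟩, hli, hw⟩ := hwf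
  set E : ℝ → ℝ := IccExtend (zero_le_one' ℝ) ((Icc (0:ℝ) 1).domRestrict D) with hE
  have hEc : Continuous E := (continuousOn_iff_continuous_domRestrict.1 hD).Icc_extend'
  have hED : ∀ u ∈ Icc (0:ℝ) 1, E u = D u := fun u hu => by
    rw [hE, IccExtend_of_mem _ _ hu]; rfl
  have hfφ : Continuous (fun x => f (φ x)) := hf.comp_continuous hφ hφm
  obtain ⟨K, hK⟩ := aux_dubois (fun ξ => D (φ ξ) * deriv φ ξ - f (φ ξ) + c * φ ξ)
    ((hli.sub hfφ.locallyIntegrable).add (continuous_const.mul hφ).locallyIntegrable) hw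
  have hA : ∀ u, HasDerivAt (fun u => ∫ t in (0:ℝ)..u, E t) (E u) u := fun u =>
    (hEc.integral_hasStrictDerivAt 0 u).hasDerivAt
  refine ⟨E, fun u => ∫ t in (0:ℝ)..u, E t, K, hEc, hED, hA, ?_⟩
  set A : ℝ → ℝ := fun u => ∫ t in (0:ℝ)..u, E t with hAdef
  have hAc : Continuous A := continuous_iff_continuousAt.2 fun u => (hA u).continuousAt
  have hgc : Continuous (fun x => f (φ x) - c * φ x + K) :=
    (hfφ.sub (continuous_const.mul hφ)).add continuous_const
  have hint : ∀ x, A (φ x) = A (φ 0) + ∫ t in (0:ℝ)..x, (f (φ t) - c * φ t + K) := by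
    intro x
    have := integral_eq_of_hasDerivAt_off_countable (fun x => A (φ x))
      (fun x => D (φ x) * deriv φ x) (a := 0) (b := x) hS (hAc.comp hφ).continuousOn
      (by
        intro y hy
        have h1 := (hA (φ y)).comp y (hSd y hy.2).hasDerivAt
        rw [hED _ (hφm y)] at h1
        exact h1)
      ((hli.integrableOn_isCompact isCompact_uIcc).intervalIntegrable)
    have e : ∫ t in (0:ℝ)..x, D (φ t) * deriv φ t =
        ∫ t in (0:ℝ)..x, (f (φ t) - c * φ t + K) := by
      apply intervalIntegral.integral_congr_ae
      filter_upwards [hK] with t ht _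
      linarith
    rw [← e, this]; ring
  intro x
  have := ((hgc.integral_hasStrictDerivAt 0 x).hasDerivAt).const_add (A (φ 0))
  exact this.congr_of_eventuallyEq (Eventually.of_forall hint)

lemma aux_lip (f : ℝ → ℝ) (hf : ContDiffOn ℝ 1 f (Icc 0 1)) :
    ∃ L : ℝ, ∀ u ∈ Icc (0:ℝ) 1, ∀ v ∈ Icc (0:ℝ) 1, |f u - f v| ≤ L * |u - v| := by
  have hc : ContinuousOn (derivWithin f (Icc 0 1)) (Icc 0 1) :=
    hf.continuousOn_derivWithin (uniqueDiffOn_Icc zero_lt_one) le_rfl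
  obtain ⟨L, hL⟩ := isCompact_Icc.exists_bound_of_continuousOn hc
  refine ⟨L, fun u hu v hv => ?_⟩
  exact (convex_Icc (0:ℝ) 1).norm_image_sub_le_of_norm_derivWithin_le
    (hf.differentiableOn one_ne_zero) hL hv hu

/-- Necessity of the chord conditions (Theorem 2.4, necessity part). -/
theorem stmt0 (f D φ : ℝ → ℝ) (α ℓm ℓp c : ℝ)
    (hf : ContDiffOn ℝ 1 f (Icc 0 1)) (hf0 : f 0 = 0)
    (hD : ContDiffOn ℝ 1 D (Icc 0 1))
    (hα : α ∈ Ioo (0:ℝ) 1)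
    (hDpos : ∀ ρ ∈ Ioo (0:ℝ) α, 0 < D ρ) (hDneg : ∀ ρ ∈ Ioo α 1, D ρ < 0)
    (hℓm : ℓm ∈ Ico (0:ℝ) α) (hℓp : ℓp ∈ Ioc α 1)
    (hwf : IsWavefront f D c ℓm ℓp φ) :
    c = (f α - f ℓm) / (α - ℓm) ∧ c = (f ℓp - f α) / (ℓp - α) ∧
    (∀ ρ ∈ Ioo ℓm α, f α + c * (ρ - α) < f ρ) ∧
    (∀ ρ ∈ Ioo α ℓp, f ρ < f α + c * (ρ - α)) := by
  obtain ⟨htw, hmon, -, hbot, htop⟩ := hwf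
  obtain ⟨hα0, hα1⟩ := hα
  obtain ⟨hm0, hmα⟩ := hℓm
  obtain ⟨hpα, hp1⟩ := hℓp
  obtain ⟨E, A, K, hEc, hED, hA, hH⟩ := aux_ode f D φ c hf.continuousOn hD.continuousOn htw
  obtain ⟨hφ, hφm, -, -, -⟩ := htw
  have hmono : Monotone φ := by
    rcases hmon with h | h
    · exact h
    · have h1 := h.le_of_tendsto htop 0
      have h2 := h.ge_of_tendsto hbot 0
      linarith
  have hAc : Continuous A := continuous_iff_continuousAt.2 fun u => (hA u).continuousAt
  have hrange : ∀ r ∈ Ioo ℓm ℓp, ∃ x, φ x = r := by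
    intro r hr
    obtain ⟨x1, h1⟩ := (hbot.eventually (gt_mem_nhds hr.1)).exists
    obtain ⟨x2, h2⟩ := (htop.eventually (lt_mem_nhds hr.2)).exists
    exact mem_range_of_exists_le_of_exists_ge hφ ⟨x1, le_of_lt h1⟩ ⟨x2, le_of_lt h2⟩
  have hAup : StrictMonoOn A (Icc 0 α) := by
    apply strictMonoOn_of_deriv_pos (convex_Icc _ _) hAc.continuousOn
    intro u hu
    rw [interior_Icc] at hu
    rw [(hA u).deriv, hED u ⟨hu.1.le, by linarith [hu.2]⟩]
    exact hDpos u hu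
  have hAdn : StrictAntiOn A (Icc α 1) := by
    apply strictAntiOn_of_deriv_neg (convex_Icc _ _) hAc.continuousOn
    intro u hu
    rw [interior_Icc] at hu
    rw [(hA u).deriv, hED u ⟨by linarith [hu.1], hu.2.le⟩]
    exact hDneg u hu
  have hmaxA : ∀ u ∈ Icc (0:ℝ) 1, A u ≤ A α := by
    intro u hu
    rcases le_total u α with h | h
    · exact hAup.monotoneOn ⟨hu.1, h⟩ ⟨hα0.le, le_rfl⟩ h
    · exact hAdn.antitoneOn ⟨le_rfl, hα1.le⟩ ⟨h, hu.2⟩ h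
  have hfc := hf.continuousOn
  have gcont : ContinuousOn (fun u => f u - c * u + K) (Icc 0 1) := by fun_prop
  -- the three zeros
  have lim : ∀ (l : Filter ℝ) (L : ℝ), L ∈ Icc (0:ℝ) 1 → Tendsto φ l (𝓝 L) →
      Tendsto (fun x => f (φ x) - c * φ x + K) l (𝓝 (f L - c * L + K)) := by
    intro l L hL ht
    exact (gcont L hL).tendsto.comp
      (tendsto_nhdsWithin_iff.2 ⟨ht, Eventually.of_forall hφm⟩)
  have hgm : f ℓm - c * ℓm + K = 0 :=
    (aux_lim_top _ _ (A ℓm) _ hH).2 ((hAc.tendsto ℓm).comp hbot)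
      (lim atBot ℓm ⟨hm0, by linarith⟩ hbot)
  have hgp : f ℓp - c * ℓp + K = 0 :=
    (aux_lim_top _ _ (A ℓp) _ hH).1 ((hAc.tendsto ℓp).comp htop)
      (lim atTop ℓp ⟨by linarith, hp1⟩ htop)
  have hgα : f α - c * α + K = 0 := by
    obtain ⟨x, hx⟩ := hrange α ⟨hmα, hpα⟩
    have hl : IsLocalMax (fun x => A (φ x)) x :=
      Eventually.of_forall fun y => by
        show A (φ y) ≤ A (φ x)
        rw [hx]; exact hmaxA _ (hφm y)
    have := hl.hasDerivAt_eq_zero (hH x)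
    rwa [hx] at this
  obtain ⟨L, hL⟩ := aux_lip (fun u => f u - c * u + K)
    ((hf.sub (contDiffOn_const.mul contDiffOn_id)).add contDiffOn_const)
  refine ⟨?_, ?_, ?_, ?_⟩
  · rw [eq_div_iff (by linarith)]; linarith
  · rw [eq_div_iff (by linarith)]; linarith
  · intro r hr
    obtain ⟨x, hx⟩ := hrange r ⟨hr.1, hr.2.trans hpα⟩
    have hnn : 0 ≤ f r - c * r + K := by
      have hU : {y | φ y < α} ∈ 𝓝 x :=
        (isOpen_lt hφ continuous_const).mem_nhds (by show φ x < α; rw [hx]; exact hr.2)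
      have hac : AccPt x (𝓟 {y | φ y < α}) :=
        accPt_principal_iff_nhdsWithin.2 (by
          rw [sdiff_eq, nhdsWithin_inter_of_mem (mem_nhdsWithin_of_mem_nhds hU)]; infer_instance)
      have := (hH x).hasDerivWithinAt.nonneg_of_monotoneOn hac (by
        intro y hy z hz hyz
        exact hAup.monotoneOn ⟨(hφm y).1, le_of_lt hy⟩ ⟨(hφm z).1, le_of_lt hz⟩ (hmono hyz))
      rwa [hx] at this
    have hb : r < (r + α) / 2 := by linarith [hr.2]
    have hb' : (r + α) / 2 < α := by linarith [hr.2]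
    obtain ⟨x1, hx1⟩ := hrange ((r + α) / 2) ⟨by linarith [hr.1], by linarith⟩
    have hne := aux_pos φ (fun u => f u - c * u + K) A E r ((r + α) / 2) L x x1 hb hφ hmono hA
      hEc (by
        intro u hu
        rw [hED u ⟨by linarith [hr.1, hu.1], by linarith [hu.2]⟩]
        exact hDpos u ⟨by linarith [hr.1, hu.1], by linarith [hu.2]⟩) hH (by
        intro u hu
        exact hL u ⟨by linarith [hr.1, hu.1], by linarith [hu.2]⟩ r
          ⟨by linarith [hr.1], by linarith⟩) hx hx1
    have := lt_of_le_of_ne hnn (Ne.symm hne)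
    linarith
  · intro r hr
    obtain ⟨x, hx⟩ := hrange r ⟨hmα.trans hr.1, hr.2⟩
    have hnn : 0 ≤ -(f r - c * r + K) := by
      have hU : {y | α < φ y} ∈ 𝓝 x :=
        (isOpen_lt continuous_const hφ).mem_nhds (by show α < φ x; rw [hx]; exact hr.1)
      have hac : AccPt x (𝓟 {y | α < φ y}) :=
        accPt_principal_iff_nhdsWithin.2 (by
          rw [sdiff_eq, nhdsWithin_inter_of_mem (mem_nhdsWithin_of_mem_nhds hU)]; infer_instance)
      have := (hH x).neg.hasDerivWithinAt.nonneg_of_monotoneOn hac (by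
        intro y hy z hz hyz
        exact neg_le_neg
          (hAdn.antitoneOn ⟨le_of_lt hy, (hφm y).2⟩ ⟨le_of_lt hz, (hφm z).2⟩ (hmono hyz)))
      rwa [hx] at this
    have hb : r < (r + ℓp) / 2 := by linarith [hr.2]
    have hb' : (r + ℓp) / 2 < ℓp := by linarith [hr.2]
    obtain ⟨x1, hx1⟩ := hrange ((r + ℓp) / 2) ⟨by linarith [hr.1], by linarith⟩
    have hne := aux_pos φ (fun u => -(f u - c * u + K)) (fun u => - A u) (fun u => - E u)
      r ((r + ℓp) / 2) L x x1 hb hφ hmono (fun u => (hA u).neg)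
      hEc.neg (by
        intro u hu
        rw [hED u ⟨by linarith [hr.1, hu.1], by linarith [hu.2]⟩]
        linarith [hDneg u ⟨by linarith [hr.1, hu.1], by linarith [hu.2]⟩])
      (fun y => (hH y).neg) (by
        intro u hu
        have := hL u ⟨by linarith [hr.1, hu.1], by linarith [hu.2]⟩ r
          ⟨by linarith [hr.1], by linarith⟩
        rw [← abs_neg]
        convert this using 2
        ring) hx hx1
    have := lt_of_le_of_ne hnn (Ne.symm hne)
    linarith
end

section
/- Assume (f) and (D1) with threshold α ∈ (0,1), let ℓ⁻ ∈ [0,α), ℓ⁺ ∈ (α,1], and suppose the chord conditions hold: c := (f(α) − f(ℓ⁻))/(α − ℓ⁻) = (f(ℓ⁺) − f(α))/(ℓ⁺ − α), f(ρ) > f(α) + c(ρ − α) on (ℓ⁻, α), and f(ρ) < f(α) + c(ρ − α) on (α, ℓ⁺). Then any two wavefront profiles from ℓ⁻ to ℓ⁺ that both satisfy the normalization φ(0) = α, φ(ξ) < α for ξ < 0, φ(ξ) > α for ξ > 0 are equal. -/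
open Set Filter MeasureTheory Topology

/-- du Bois-Reymond lemma. -/
lemma aux_dbr (w : ℝ → ℝ) (hw : LocallyIntegrable w)
    (h : ∀ ψ : ℝ → ℝ, ContDiff ℝ (⊤ : ℕ∞) ψ → HasCompactSupport ψ → ∫ ξ, w ξ * deriv ψ ξ = 0) :
    ∃ K : ℝ, ∀ᵐ x, w x = K := by
  let b : ContDiffBump (0:ℝ) := ⟨1, 2, by norm_num, by norm_num⟩
  let η : ℝ → ℝ := b.normed volume
  have hη : ContDiff ℝ (⊤ : ℕ∞) η := b.contDiff_normed
  have hηs : HasCompactSupport η := b.hasCompactSupport_normed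
  have hηi : ∫ x, η x = 1 := b.integral_normed
  refine ⟨∫ x, w x * η x, ?_⟩
  set K := ∫ x, w x * η x with hK
  have key : ∀ᵐ x, w x - K = 0 := by
    apply ae_eq_zero_of_integral_contDiff_smul_eq_zero
      (hw.sub (locallyIntegrable_const K))
    intro g hg hgs
    have hgint : Integrable g := hg.continuous.integrable_of_hasCompactSupport hgs
    have hηint : Integrable η := hη.continuous.integrable_of_hasCompactSupport hηs
    set m := ∫ x, g x with hm
    let χ : ℝ → ℝ := fun x => g x - m * η x
    have hχ : ContDiff ℝ (⊤ : ℕ∞) χ := hg.sub (contDiff_const.mul hη)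
    have hχs : HasCompactSupport χ := by
      have h2 : HasCompactSupport (fun x => m * η x) := hηs.mul_left
      exact hgs.sub h2
    have hχint : Integrable χ := hχ.continuous.integrable_of_hasCompactSupport hχs
    have hχ0 : ∫ x, χ x = 0 := by
      simp only [χ]
      rw [integral_sub hgint (hηint.const_mul m), integral_const_mul, hηi]
      simp [hm]
    obtain ⟨R, hR⟩ := hχs.isCompact.isBounded.subset_closedBall (0:ℝ)
    have hz : ∀ x, R < |x| → χ x = 0 := by
      intro x hx
      by_contra hne
      have := hR (subset_tsupport χ hne)
      simp [Metric.mem_closedBall] at this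
      linarith
    let ψ : ℝ → ℝ := fun x => ∫ t in Iic x, χ t
    have hψ2 : ∀ x, ψ x = ψ 0 + ∫ t in (0:ℝ)..x, χ t := by
      intro x
      rw [intervalIntegral.integral_Iic_sub_Iic hχint.integrableOn hχint.integrableOn |>.symm]
      simp [ψ]
    have hψd : ∀ x, HasDerivAt ψ (χ x) x := by
      intro x
      have : ψ = fun x => ψ 0 + ∫ t in (0:ℝ)..x, χ t := funext hψ2
      rw [this]
      exact (hχ.continuous.integral_hasStrictDerivAt 0 x).hasDerivAt.const_add _
    have hdψ : deriv ψ = χ := funext fun x => (hψd x).deriv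
    have hψc : ContDiff ℝ (⊤ : ℕ∞) ψ := by
      rw [contDiff_infty_iff_deriv]
      exact ⟨fun x => (hψd x).differentiableAt, by rw [hdψ]; exact hχ⟩
    have hψs : HasCompactSupport ψ := by
      apply HasCompactSupport.intro (isCompact_Icc (a := -R) (b := R))
      intro x hx
      rcases lt_or_ge x (-R) with h1 | h1
      · simp only [ψ]
        apply setIntegral_eq_zero_of_forall_eq_zero
        intro t ht
        apply hz
        have : t < -R := lt_of_le_of_lt ht h1
        have := neg_abs_le t
        linarith
      · have h2 : R < x := by
          by_contra h3
          exact hx ⟨h1, not_lt.1 h3⟩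
        have h4 : ∫ t in Iic x, χ t = ∫ t, χ t := by
          apply setIntegral_eq_integral_of_forall_compl_eq_zero
          intro t ht
          apply hz
          have : x < t := not_le.1 ht
          have := le_abs_self t
          linarith
        simp only [ψ]
        rw [h4, hχ0]
    have h5 := h ψ hψc hψs
    rw [hdψ] at h5
    have iwg : Integrable (fun x => w x * g x) := by
      have := hw.integrable_smul_left_of_hasCompactSupport hg.continuous hgs
      simpa [mul_comm] using this
    have iwη : Integrable (fun x => w x * η x) := by
      have := hw.integrable_smul_left_of_hasCompactSupport hη.continuous hηs
      simpa [mul_comm] using this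
    have h6 : ∫ x, w x * χ x = (∫ x, w x * g x) - m * K := by
      rw [hK, ← integral_const_mul, ← integral_sub iwg (iwη.const_mul m)]
      congr 1; ext x; simp only [χ]; ring
    have h7 : ∫ x, g x • (w x - K) = (∫ x, w x * g x) - K * m := by
      rw [hm, ← integral_const_mul, ← integral_sub iwg (hgint.const_mul K)]
      congr 1; ext x; simp; ring
    have h8 : ∫ x, g x • (w x - K) = 0 := by rw [h7]; linarith
    exact h8
  filter_upwards [key] with x hx
  linarith

/-- One-sided comparison for the autonomous ODE reaching `B` at time zero. -/
lemma aux_le (A B : ℝ) (H u v : ℝ → ℝ) (hHc : ContinuousOn H (Ioo A B))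
    (hHp : ∀ s ∈ Ioo A B, 0 < H s)
    (hu : Continuous u) (hv : Continuous v) (hum : Monotone u) (hvm : Monotone v)
    (hv0 : v 0 = B)
    (huA : ∀ x < 0, u x < B) (hvA : ∀ x < 0, A ≤ v x ∧ v x < B)
    (hud : ∀ x < 0, u x ∈ Ioo A B → HasDerivAt u (H (u x)) x)
    (hvd : ∀ x < 0, v x ∈ Ioo A B → HasDerivAt v (H (v x)) x) :
    ∀ x < 0, u x ≤ v x := by
  intro x hx
  by_contra hlt
  push Not at hlt
  have hux : A < u x := lt_of_le_of_lt (hvA x hx).1 hlt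
  have huB := huA x hx
  obtain ⟨y, hy, hvy⟩ : u x ∈ v '' Icc x 0 :=
    intermediate_value_Icc hx.le hv.continuousOn ⟨hlt.le, by rw [hv0]; exact huB.le⟩
  have hxy : x < y := lt_of_le_of_ne hy.1 (by rintro rfl; linarith)
  have hy0 : y < 0 := lt_of_le_of_ne hy.2 (by rintro rfl; linarith)
  set m := u x with hm
  have hmI : m ∈ Ioo A B := ⟨hux, huB⟩
  have hic : ContinuousOn (fun s => (H s)⁻¹) (Ioo A B) :=
    hHc.inv₀ fun s hs => (hHp s hs).ne'
  let F : ℝ → ℝ := fun s => ∫ r in m..s, (H r)⁻¹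
  have hF : ∀ s ∈ Ioo A B, HasDerivAt F ((H s)⁻¹) s := by
    intro s hs
    apply intervalIntegral.integral_hasDerivAt_right
    · apply ContinuousOn.intervalIntegrable
      exact hic.mono (ordConnected_Ioo.uIcc_subset hmI hs)
    · exact hic.stronglyMeasurableAtFilter isOpen_Ioo s hs
    · exact hic.continuousAt (isOpen_Ioo.mem_nhds hs)
  have hFm : StrictMonoOn F (Ioo A B) := by
    apply strictMonoOn_of_deriv_pos (convex_Ioo A B)
    · exact fun s hs => (hF s hs).continuousAt.continuousWithinAt
    · intro s hs
      rw [interior_Ioo] at hs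
      rw [(hF s hs).deriv]
      exact inv_pos.2 (hHp s hs)
  have huI : ∀ t, 0 ≤ t → t < -y → u (x + t) ∈ Ioo A B := fun t h0 h1 =>
    ⟨lt_of_lt_of_le hux (hum (by linarith)), huA _ (by linarith)⟩
  have hvI : ∀ t, 0 ≤ t → t < -y → v (y + t) ∈ Ioo A B := fun t h0 h1 =>
    ⟨lt_of_lt_of_le hux (hvy ▸ hvm (by linarith)), (hvA _ (by linarith)).2⟩
  have hd1 : ∀ t, 0 ≤ t → t < -y → HasDerivAt (fun t => F (u (x + t)) - F (v (y + t))) 0 t := by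
    intro t h0 h1
    have a1 := (hud (x + t) (by linarith) (huI t h0 h1)).comp_const_add x t
    have a2 := (hF _ (huI t h0 h1)).comp t a1
    have b1 := (hvd (y + t) (by linarith) (hvI t h0 h1)).comp_const_add y t
    have b2 := (hF _ (hvI t h0 h1)).comp t b1
    have := a2.sub b2
    rw [inv_mul_cancel₀ (hHp _ (huI t h0 h1)).ne', inv_mul_cancel₀ (hHp _ (hvI t h0 h1)).ne',
      sub_self] at this
    exact this
  have heq : ∀ t ∈ Ico 0 (-y), u (x + t) = v (y + t) := by
    intro t ht
    have := constant_of_has_deriv_right_zero (a := 0) (b := t)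
      (f := fun t => F (u (x + t)) - F (v (y + t)))
      (fun s hs => (hd1 s hs.1 (by linarith [hs.2, ht.2])).continuousAt.continuousWithinAt)
      (fun s hs => (hd1 s hs.1 (by linarith [hs.2, ht.2])).hasDerivWithinAt) t ⟨ht.1, le_rfl⟩
    simp only [add_zero, hvy, ← hm, sub_self] at this
    exact hFm.injOn (huI t ht.1 ht.2) (hvI t ht.1 ht.2) (by linarith)
  have hcl : IsClosed {t | u (x + t) = v (y + t)} :=
    isClosed_eq (hu.comp (continuous_const.add continuous_id))
      (hv.comp (continuous_const.add continuous_id))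
  have hsub : closure (Ico 0 (-y)) ⊆ {t | u (x + t) = v (y + t)} :=
    hcl.closure_subset_iff.2 heq
  rw [closure_Ico (by linarith)] at hsub
  have h8 : u (x + -y) = v (y + -y) := hsub ⟨by linarith, le_rfl⟩
  rw [add_neg_cancel, hv0] at h8
  have := huA (x + -y) (by linarith)
  linarith

/-- If the primitive has a limit and its derivative converges, the derivative tends to zero. -/
lemma aux_lim (l : Filter ℝ) [l.NeBot] (u g : ℝ → ℝ) (a b : ℝ) (ζ : ℝ → ℝ)
    (hs : Tendsto (fun x => x + 1) l l)
    (hζ : Tendsto ζ l l) (hu : Tendsto u l (𝓝 a)) (hg : Tendsto g l (𝓝 b))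
    (h : ∀ x, u (x + 1) - u x = g (ζ x)) : b = 0 := by
  have h1 : Tendsto (fun x => u (x + 1) - u x) l (𝓝 (a - a)) := (hu.comp hs).sub hu
  have h2 : Tendsto (fun x => u (x + 1) - u x) l (𝓝 b) := by
    simp_rw [h]; exact hg.comp hζ
  have := tendsto_nhds_unique h1 h2
  linarith

/-- Everything we need to know about a single profile (with continuous coefficients). -/
lemma aux_profile (f D : ℝ → ℝ) (α ℓm ℓp c c₁ : ℝ) (hf : Continuous f) (hD : Continuous D)
    (hα : α ∈ Ioo (0:ℝ) 1)
    (hDpos : ∀ ρ ∈ Ioo (0:ℝ) α, 0 < D ρ) (hDneg : ∀ ρ ∈ Ioo α 1, D ρ < 0)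
    (hℓm : ℓm ∈ Ico (0:ℝ) α) (hℓp : ℓp ∈ Ioc α 1)
    (hc1 : c = (f α - f ℓm) / (α - ℓm)) (φ : ℝ → ℝ)
    (h : IsWavefront f D c₁ ℓm ℓp φ)
    (hn : φ 0 = α ∧ (∀ ξ < (0:ℝ), φ ξ < α) ∧ (∀ ξ > (0:ℝ), α < φ ξ)) :
    Continuous φ ∧ Monotone φ ∧ (∀ x, ℓm ≤ φ x ∧ φ x ≤ ℓp) ∧
    ∀ x, D (φ x) ≠ 0 → HasDerivAt φ ((f (φ x) - f α - c * (φ x - α)) / D (φ x)) x := by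
  obtain ⟨⟨hφ, hφI, ⟨S, hS, hdiff⟩, hint, hweak⟩, hmono, -, hbot, htop⟩ := h
  have hmono : Monotone φ := by
    rcases hmono with h | h
    · exact h
    · have := h (show (-1:ℝ) ≤ 1 by norm_num)
      linarith [hn.2.1 (-1) (by norm_num), hn.2.2 1 (by norm_num)]
  have hrange : ∀ x, ℓm ≤ φ x ∧ φ x ≤ ℓp := fun x =>
    ⟨hmono.le_of_tendsto hbot x, hmono.ge_of_tendsto htop x⟩
  have hcg : Continuous (fun x => f (φ x) - c₁ * φ x) :=
    (hf.comp hφ).sub (continuous_const.mul hφ)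
  obtain ⟨K, hK⟩ := aux_dbr (fun ξ => D (φ ξ) * deriv φ ξ - f (φ ξ) + c₁ * φ ξ) (by
    have := hint.sub hcg.locallyIntegrable
    refine this.congr (ae_of_all _ fun x => ?_)
    simp; ring) hweak
  let G : ℝ → ℝ := fun ρ => f ρ - c₁ * ρ + K
  have hG : Continuous G := (hf.sub (continuous_const.mul continuous_id)).add continuous_const
  let P : ℝ → ℝ := fun ρ => ∫ s in (0:ℝ)..ρ, D s
  have hP : ∀ ρ, HasStrictDerivAt P (D ρ) ρ := fun ρ => hD.integral_hasStrictDerivAt 0 ρ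
  have hPc : Continuous P := continuous_iff_continuousAt.2 fun ρ => (hP ρ).hasDerivAt.continuousAt
  have hu1 : ∀ x, P (φ x) = P (φ 0) + ∫ t in (0:ℝ)..x, G (φ t) := by
    intro x
    have h1 := integral_eq_of_hasDerivAt_off_countable (fun x => P (φ x))
      (fun ξ => D (φ ξ) * deriv φ ξ) (a := 0) (b := x) hS (hPc.comp hφ).continuousOn
      (fun y hy => (hP (φ y)).hasDerivAt.comp y (hdiff y hy.2).hasDerivAt)
      (hint.integrableOn_isCompact isCompact_uIcc).intervalIntegrable
    have h2 : ∫ t in (0:ℝ)..x, G (φ t) = ∫ t in (0:ℝ)..x, D (φ t) * deriv φ t := by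
      apply intervalIntegral.integral_congr_ae
      filter_upwards [hK] with t ht _
      simp only [G]; linarith
    rw [h2, h1]; ring
  have hu : ∀ x, HasDerivAt (fun x => P (φ x)) (G (φ x)) x := by
    intro x
    have : (fun x => P (φ x)) = fun x => P (φ 0) + ∫ t in (0:ℝ)..x, G (φ t) := funext hu1
    rw [this]
    exact ((hG.comp hφ).integral_hasStrictDerivAt 0 x).hasDerivAt.const_add _
  have hGα : G α = 0 := by
    have hmax : IsLocalMax (fun x => P (φ x)) 0 := by
      apply Filter.Eventually.of_forall
      intro x
      show P (φ x) ≤ P (φ 0)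
      rw [hn.1]
      have hx := hφI x
      rcases le_total (φ x) α with hle | hle
      · have : MonotoneOn P (Icc 0 α) := by
          apply monotoneOn_of_deriv_nonneg (convex_Icc _ _) hPc.continuousOn
            (fun s _ => (hP s).hasDerivAt.differentiableAt.differentiableWithinAt)
          intro s hs
          rw [interior_Icc] at hs
          rw [(hP s).hasDerivAt.deriv]
          exact (hDpos s hs).le
        exact this ⟨hx.1, hle⟩ ⟨hα.1.le, le_rfl⟩ hle
      · have : AntitoneOn P (Icc α 1) := by
          apply antitoneOn_of_deriv_nonpos (convex_Icc _ _) hPc.continuousOn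
            (fun s _ => (hP s).hasDerivAt.differentiableAt.differentiableWithinAt)
          intro s hs
          rw [interior_Icc] at hs
          rw [(hP s).hasDerivAt.deriv]
          exact (hDneg s hs).le
        exact this ⟨le_rfl, hα.2.le⟩ ⟨hle, hx.2⟩ hle
    have := hmax.hasDerivAt_eq_zero (hu 0)
    rwa [hn.1] at this
  have hmvt : ∀ x, ∃ z, x < z ∧ z < x + 1 ∧ P (φ (x + 1)) - P (φ x) = G (φ z) := by
    intro x
    obtain ⟨z, hz, he⟩ := exists_hasDerivAt_eq_slope (fun x => P (φ x)) (fun x => G (φ x))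
      (show x < x + 1 by linarith) (hPc.comp hφ).continuousOn (fun y _ => hu y)
    refine ⟨z, hz.1, hz.2, ?_⟩
    simp at he
    exact he.symm
  choose ζ hζ1 hζ2 hζ3 using hmvt
  have hGm : G ℓm = 0 := by
    apply aux_lim atBot (fun x => P (φ x)) (fun x => G (φ x)) (P ℓm) (G ℓm) ζ
    · exact tendsto_atBot_add_const_right _ _ tendsto_id
    · exact tendsto_atBot_mono (fun x => (hζ2 x).le)
        (tendsto_atBot_add_const_right _ _ tendsto_id)
    · exact (hPc.tendsto _).comp hbot
    · exact (hG.tendsto _).comp hbot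
    · exact hζ3
  have hcc : c₁ = c := by
    have : α - ℓm ≠ 0 := by linarith [hℓm.2]
    rw [hc1, eq_div_iff this]
    simp only [G] at hGα hGm
    linarith
  have hKv : ∀ ρ, G ρ = f ρ - f α - c * (ρ - α) := by
    intro ρ
    rw [← hcc]
    simp only [G] at hGα ⊢
    linarith
  refine ⟨hφ, hmono, hrange, fun x hx => ?_⟩
  have h1 := ((hP (φ x)).to_localInverse hx).hasDerivAt.comp x (hu x)
  have h2 := h1.congr_of_eventuallyEq (f₁ := φ) (by
    filter_upwards [hφ.continuousAt.eventually ((hP (φ x)).eventually_left_inverse hx)] with y hy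
    exact hy.symm)
  rw [hKv] at h2
  rw [div_eq_inv_mul]
  exact h2

/-- Uniqueness of the normalized wavefront profile (Theorem 2.4, uniqueness). -/
theorem stmt3 (f D : ℝ → ℝ) (α ℓm ℓp c : ℝ)
    (hf : ContDiffOn ℝ 1 f (Icc 0 1)) (hf0 : f 0 = 0)
    (hD : ContDiffOn ℝ 1 D (Icc 0 1))
    (hα : α ∈ Ioo (0:ℝ) 1)
    (hDpos : ∀ ρ ∈ Ioo (0:ℝ) α, 0 < D ρ) (hDneg : ∀ ρ ∈ Ioo α 1, D ρ < 0)
    (hℓm : ℓm ∈ Ico (0:ℝ) α) (hℓp : ℓp ∈ Ioc α 1)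
    (hc1 : c = (f α - f ℓm) / (α - ℓm)) (hc2 : c = (f ℓp - f α) / (ℓp - α))
    (hchord1 : ∀ ρ ∈ Ioo ℓm α, f α + c * (ρ - α) < f ρ)
    (hchord2 : ∀ ρ ∈ Ioo α ℓp, f ρ < f α + c * (ρ - α))
    (c₁ c₂ : ℝ) (φ₁ φ₂ : ℝ → ℝ)
    (h₁ : IsWavefront f D c₁ ℓm ℓp φ₁)
    (hn₁ : φ₁ 0 = α ∧ (∀ ξ < (0:ℝ), φ₁ ξ < α) ∧ (∀ ξ > (0:ℝ), α < φ₁ ξ))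
    (h₂ : IsWavefront f D c₂ ℓm ℓp φ₂)
    (hn₂ : φ₂ 0 = α ∧ (∀ ξ < (0:ℝ), φ₂ ξ < α) ∧ (∀ ξ > (0:ℝ), α < φ₂ ξ)) :
    φ₁ = φ₂ := by
  have e01 : (0:ℝ) ≤ 1 := zero_le_one
  let p : ℝ → ℝ := fun x => (projIcc (0:ℝ) 1 e01 x : ℝ)
  have hpc : Continuous p := continuous_subtype_val.comp continuous_projIcc
  have hpI : ∀ x, p x ∈ Icc (0:ℝ) 1 := fun x => (projIcc (0:ℝ) 1 e01 x).2
  have hpe : ∀ x ∈ Icc (0:ℝ) 1, p x = x := fun x hx => by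
    simp only [p]; rw [projIcc_of_mem e01 hx]
  obtain ⟨F, hF⟩ : ∃ F : ℝ → ℝ, F = fun x => f (p x) := ⟨_, rfl⟩
  obtain ⟨E, hE⟩ : ∃ E : ℝ → ℝ, E = fun x => D (p x) := ⟨_, rfl⟩
  have hFc : Continuous F := by rw [hF]; exact hf.continuousOn.comp_continuous hpc hpI
  have hEc : Continuous E := by rw [hE]; exact hD.continuousOn.comp_continuous hpc hpI
  have hFe : ∀ x ∈ Icc (0:ℝ) 1, F x = f x := fun x hx => by rw [hF]; simp only [hpe x hx]
  have hEe : ∀ x ∈ Icc (0:ℝ) 1, E x = D x := fun x hx => by rw [hE]; simp only [hpe x hx]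
  have hconv : ∀ (k : ℝ) (φ : ℝ → ℝ), IsWavefront f D k ℓm ℓp φ →
      IsWavefront F E k ℓm ℓp φ := by
    rintro k φ ⟨⟨a1, a2, a3, a4, a5⟩, a6⟩
    refine ⟨⟨a1, a2, a3, ?_, ?_⟩, a6⟩
    · have : (fun ξ => E (φ ξ) * deriv φ ξ) = fun ξ => D (φ ξ) * deriv φ ξ := by
        ext ξ; rw [hEe _ (a2 ξ)]
      rw [this]; exact a4
    · intro ψ h1 h2
      have := a5 ψ h1 h2
      rw [← this]
      congr 1
      ext ξ; rw [hEe _ (a2 ξ), hFe _ (a2 ξ)]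
  have iα : α ∈ Icc (0:ℝ) 1 := ⟨hα.1.le, hα.2.le⟩
  have im : ℓm ∈ Icc (0:ℝ) 1 := ⟨hℓm.1, by linarith [hℓm.2, hα.2]⟩
  have hEpos : ∀ ρ ∈ Ioo (0:ℝ) α, 0 < E ρ := fun ρ hρ => by
    rw [hEe ρ ⟨hρ.1.le, by linarith [hρ.2, hα.2]⟩]; exact hDpos ρ hρ
  have hEneg : ∀ ρ ∈ Ioo α 1, E ρ < 0 := fun ρ hρ => by
    rw [hEe ρ ⟨by linarith [hρ.1, hα.1], hρ.2.le⟩]; exact hDneg ρ hρ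
  have hc1' : c = (F α - F ℓm) / (α - ℓm) := by rw [hFe α iα, hFe ℓm im]; exact hc1
  obtain ⟨k1, m1, r1, d1⟩ := aux_profile F E α ℓm ℓp c c₁ hFc hEc hα hEpos hEneg hℓm hℓp hc1'
    φ₁ (hconv _ _ h₁) hn₁
  obtain ⟨k2, m2, r2, d2⟩ := aux_profile F E α ℓm ℓp c c₂ hFc hEc hα hEpos hEneg hℓm hℓp hc1'
    φ₂ (hconv _ _ h₂) hn₂
  obtain ⟨H, hH⟩ : ∃ H : ℝ → ℝ, H = fun ρ => (F ρ - F α - c * (ρ - α)) / E ρ := ⟨_, rfl⟩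
  have hEp : ∀ ρ ∈ Ioo ℓm α, 0 < E ρ := fun ρ hρ => hEpos ρ ⟨by linarith [hℓm.1, hρ.1], hρ.2⟩
  have hEn : ∀ ρ ∈ Ioo α ℓp, E ρ < 0 := fun ρ hρ => hEneg ρ ⟨hρ.1, by linarith [hℓp.2, hρ.2]⟩
  have hNc : Continuous fun ρ => F ρ - F α - c * (ρ - α) := by fun_prop
  have hHc1 : ContinuousOn H (Ioo ℓm α) := by
    rw [hH]; exact hNc.continuousOn.div hEc.continuousOn fun ρ hρ => (hEp ρ hρ).ne'
  have hHc2 : ContinuousOn H (Ioo α ℓp) := by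
    rw [hH]; exact hNc.continuousOn.div hEc.continuousOn fun ρ hρ => (hEn ρ hρ).ne
  have hHp1 : ∀ ρ ∈ Ioo ℓm α, 0 < H ρ := fun ρ hρ => by
    rw [hH]
    apply div_pos _ (hEp ρ hρ)
    rw [hFe ρ ⟨by linarith [hℓm.1, hρ.1], by linarith [hα.2, hρ.2]⟩, hFe α iα]
    linarith [hchord1 ρ hρ]
  have hHp2 : ∀ ρ ∈ Ioo α ℓp, 0 < H ρ := fun ρ hρ => by
    rw [hH]
    apply div_pos_of_neg_of_neg _ (hEn ρ hρ)
    rw [hFe ρ ⟨by linarith [hα.1, hρ.1], by linarith [hℓp.2, hρ.2]⟩, hFe α iα]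
    linarith [hchord2 ρ hρ]
  -- one-sided comparison, for both orders of the two profiles
  have left : ∀ u v : ℝ → ℝ, Continuous u → Continuous v → Monotone u → Monotone v →
      (∀ x, ℓm ≤ u x ∧ u x ≤ ℓp) → (∀ x, ℓm ≤ v x ∧ v x ≤ ℓp) →
      (∀ x, E (u x) ≠ 0 → HasDerivAt u ((F (u x) - F α - c * (u x - α)) / E (u x)) x) →
      (∀ x, E (v x) ≠ 0 → HasDerivAt v ((F (v x) - F α - c * (v x - α)) / E (v x)) x) →
      (∀ ξ < (0:ℝ), u ξ < α) → v 0 = α → (∀ ξ < (0:ℝ), v ξ < α) → ∀ x < 0, u x ≤ v x := by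
    intro u v hu hv mu mv ru rv du dv lu v0 lv
    apply aux_le ℓm α H u v hHc1 hHp1 hu hv mu mv v0 lu (fun x hx => ⟨(rv x).1, lv x hx⟩)
    · intro x hx hI
      rw [hH]; exact du x (hEp _ hI).ne'
    · intro x hx hI
      rw [hH]; exact dv x (hEp _ hI).ne'
  have right : ∀ u v : ℝ → ℝ, Continuous u → Continuous v → Monotone u → Monotone v →
      (∀ x, ℓm ≤ u x ∧ u x ≤ ℓp) → (∀ x, ℓm ≤ v x ∧ v x ≤ ℓp) →
      (∀ x, E (u x) ≠ 0 → HasDerivAt u ((F (u x) - F α - c * (u x - α)) / E (u x)) x) →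
      (∀ x, E (v x) ≠ 0 → HasDerivAt v ((F (v x) - F α - c * (v x - α)) / E (v x)) x) →
      (∀ ξ > (0:ℝ), α < u ξ) → v 0 = α → (∀ ξ > (0:ℝ), α < v ξ) → ∀ x > 0, v x ≤ u x := by
    intro u v hu hv mu mv ru rv du dv lu v0 lv
    have hmem : ∀ s ∈ Ioo (-ℓp) (-α), -s ∈ Ioo α ℓp := fun s hs =>
      ⟨by linarith [hs.2], by linarith [hs.1]⟩
    have hder : ∀ w : ℝ → ℝ,
        (∀ x, E (w x) ≠ 0 → HasDerivAt w ((F (w x) - F α - c * (w x - α)) / E (w x)) x) →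
        ∀ x < 0, -w (-x) ∈ Ioo (-ℓp) (-α) →
          HasDerivAt (fun x => -w (-x)) (H (-(-w (-x)))) x := by
      intro w dw x hx hI
      have hI' := hmem _ hI
      rw [neg_neg] at hI' ⊢
      have h1 := ((dw (-x) (hEn _ hI').ne).scomp x (hasDerivAt_neg x)).neg
      rw [hH]
      exact HasDerivAt.congr_deriv h1 (by simp)
    have key := aux_le (-ℓp) (-α) (fun s => H (-s)) (fun x => -u (-x)) (fun x => -v (-x))
      (hHc2.comp continuous_neg.continuousOn hmem) (fun s hs => hHp2 _ (hmem s hs))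
      (hu.comp continuous_neg).neg (hv.comp continuous_neg).neg
      (fun a b hab => neg_le_neg (mu (neg_le_neg hab)))
      (fun a b hab => neg_le_neg (mv (neg_le_neg hab)))
      (by simp [v0]) (fun x hx => neg_lt_neg (lu (-x) (by linarith)))
      (fun x hx => ⟨neg_le_neg (rv (-x)).2, neg_lt_neg (lv (-x) (by linarith))⟩)
      (hder u du) (hder v dv)
    intro x hx
    have := key (-x) (by linarith)
    simp only [neg_neg] at this
    linarith
  ext x
  rcases lt_trichotomy x 0 with hx | rfl | hx
  · exact le_antisymm
      (left φ₁ φ₂ k1 k2 m1 m2 r1 r2 d1 d2 hn₁.2.1 hn₂.1 hn₂.2.1 x hx)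
      (left φ₂ φ₁ k2 k1 m2 m1 r2 r1 d2 d1 hn₂.2.1 hn₁.1 hn₁.2.1 x hx)
  · rw [hn₁.1, hn₂.1]
  · exact le_antisymm
      (right φ₂ φ₁ k2 k1 m2 m1 r2 r1 d2 d1 hn₂.2.2 hn₁.1 hn₁.2.2 x hx)
      (right φ₁ φ₂ k1 k2 m1 m2 r1 r2 d1 d2 hn₁.2.2 hn₂.1 hn₂.2.2 x hx)
end

section
/- Assume (f) and (D1) with threshold α ∈ (0,1), let ℓ⁻ ∈ [0,α), ℓ⁺ ∈ (α,1], assume the chord conditions with common slope c, and let φ be the wavefront profile from ℓ⁻ to ℓ⁺ normalized by φ(0) = α, φ(ξ) < α for ξ < 0, φ(ξ) > α for ξ > 0. Then: if D′(α) < 0, the limit lim_{ξ→0} φ′(ξ) exists and equals (f′(α) − c)/D′(α); if D′(α) = 0 and f′(α) − c < 0, then φ′(ξ) → +∞ as ξ → 0. -/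
open Set Filter MeasureTheory Topology

/-- du Bois-Reymond lemma: a locally integrable function with zero weak derivative is a.e. constant. -/
lemma duBoisReymond (G : ℝ → ℝ) (hG : LocallyIntegrable G)
    (h : ∀ ψ : ℝ → ℝ, ContDiff ℝ (⊤ : ℕ∞) ψ → HasCompactSupport ψ →
      ∫ ξ, G ξ * deriv ψ ξ = 0) : ∃ k : ℝ, ∀ᵐ x, G x = k := by
  let b : ContDiffBump (0:ℝ) := ⟨1, 2, one_pos, one_lt_two⟩
  let χ : ℝ → ℝ := b.normed volume
  have hχs : ContDiff ℝ (⊤ : ℕ∞) χ := b.contDiff_normed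
  have hχc : HasCompactSupport χ := b.hasCompactSupport_normed
  have hχ1 : ∫ x, χ x = 1 := b.integral_normed
  refine ⟨∫ x, G x * χ x, ?_⟩
  set k := ∫ x, G x * χ x with hk
  have key := ae_eq_zero_of_integral_contDiff_smul_eq_zero (f := fun x => G x - k) (μ := volume)
    (hG.sub (locallyIntegrable_const k)) ?_
  · filter_upwards [key] with x hx
    linarith
  intro η hη hηc
  set m := ∫ x, η x with hm
  let θ : ℝ → ℝ := fun x => η x - m * χ x
  have hθs : ContDiff ℝ (⊤ : ℕ∞) θ := hη.sub (contDiff_const.mul hχs)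
  have hθc : HasCompactSupport θ := hηc.sub (hχc.mul_left (f := fun _ => m))
  have hηi : Integrable η := hη.continuous.integrable_of_hasCompactSupport hηc
  have hχi : Integrable χ := hχs.continuous.integrable_of_hasCompactSupport hχc
  have hθ0 : ∫ x, θ x = 0 := by
    have : ∫ x, θ x = (∫ x, η x) - ∫ x, m * χ x := integral_sub hηi (hχi.const_mul m)
    rw [this, integral_const_mul, hχ1]
    simp [hm]
  obtain ⟨R, hR⟩ := hθc.isCompact.isBounded.subset_closedBall (0:ℝ)
  have hθz : ∀ x, θ x ≠ 0 → |x| ≤ R := by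
    intro x hx
    have := hR (subset_tsupport θ hx)
    simpa using this
  let ψ : ℝ → ℝ := fun x => ∫ t in (-R-1)..x, θ t
  have hψd : ∀ x, HasDerivAt ψ (θ x) x := fun x =>
    intervalIntegral.integral_hasDerivAt_right (hθs.continuous.intervalIntegrable _ _)
      hθs.continuous.stronglyMeasurable.stronglyMeasurableAtFilter hθs.continuous.continuousAt
  have hψ' : deriv ψ = θ := funext fun x => (hψd x).deriv
  have hψs : ContDiff ℝ (⊤ : ℕ∞) ψ := by
    rw [contDiff_infty_iff_deriv, hψ']
    exact ⟨fun x => (hψd x).differentiableAt, hθs⟩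
  have hψc : HasCompactSupport ψ := by
    refine HasCompactSupport.intro (isCompact_Icc (a := -R-1) (b := R)) ?_
    intro x hx
    by_cases h1 : x < -R-1
    · show ∫ t in (-R-1)..x, θ t = 0
      have : ∫ t in (-R-1)..x, θ t = ∫ t in (-R-1)..x, (0:ℝ) := by
        apply intervalIntegral.integral_congr
        intro t ht
        rw [uIcc_of_ge h1.le] at ht
        by_contra hne
        have := abs_le.1 (hθz t hne)
        linarith [ht.2, this.1]
      rw [this]; simp
    · have h2 : R < x := by
        by_contra h2
        exact hx ⟨not_lt.1 h1, not_lt.1 h2⟩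
      show ∫ t in (-R-1)..x, θ t = 0
      rw [intervalIntegral.integral_eq_integral_of_support_subset, hθ0]
      intro t ht
      have := abs_le.1 (hθz t ht)
      exact ⟨by linarith [this.1], by linarith [this.2]⟩
  have h0 := h ψ hψs hψc
  rw [hψ'] at h0
  have i1 : Integrable (fun x => G x * η x) := by
    simpa using hG.integrable_smul_right_of_hasCompactSupport hη.continuous hηc
  have i2 : Integrable (fun x => G x * χ x) := by
    simpa using hG.integrable_smul_right_of_hasCompactSupport hχs.continuous hχc
  have e1 : ∫ x, G x * θ x = (∫ x, G x * η x) - m * k := by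
    have : ∀ x, G x * θ x = G x * η x - m * (G x * χ x) := fun x => by
      simp only [θ]; ring
    simp_rw [this]
    rw [integral_sub i1 (i2.const_mul m), integral_const_mul]
  have e2 : ∫ x, η x • (G x - k) = (∫ x, G x * η x) - k * m := by
    have : ∀ x, η x • (G x - k) = G x * η x - k * η x := fun x => by
      simp only [smul_eq_mul]; ring
    simp_rw [this]
    rw [integral_sub i1 (hηi.const_mul k), integral_const_mul]
  rw [e2]
  linarith

/-- Pointwise ODE where the coefficient does not vanish. -/
lemma pointwise_ode (φ d g : ℝ → ℝ) (hφ : Continuous φ) (hd : Continuous d) (hg : Continuous g)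
    (S : Set ℝ) (hS : S.Countable) (hdiff : ∀ ξ ∉ S, DifferentiableAt ℝ φ ξ)
    (hae : ∀ᵐ ξ, d ξ * deriv φ ξ = g ξ) (x : ℝ) (hx : d x ≠ 0) :
    deriv φ x = g x / d x := by
  have hev : ∀ᶠ y in 𝓝 x, d y ≠ 0 := hd.continuousAt.eventually_ne hx
  obtain ⟨ε, hε, hball⟩ := Metric.eventually_nhds_iff_ball.1 hev
  let q : ℝ → ℝ := fun y => g y / d y
  have hqm : Measurable q := hg.measurable.div hd.measurable
  have hqc : ContinuousAt q x := hg.continuousAt.div hd.continuousAt hx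
  have hI : HasDerivAt (fun y => ∫ t in x..y, q t) (q x) x :=
    intervalIntegral.integral_hasDerivAt_right (by simp)
      hqm.stronglyMeasurable.stronglyMeasurableAtFilter hqc
  have hloc : (fun y => φ x + ∫ t in x..y, q t) =ᶠ[𝓝 x] φ := by
    filter_upwards [Metric.ball_mem_nhds x hε] with y hy
    have hsub : uIcc x y ⊆ Metric.ball x ε := by
      have hc : Convex ℝ (Metric.ball x ε) := convex_ball x ε
      have := hc.ordConnected.uIcc_subset (Metric.mem_ball_self hε) hy
      exact this
    have hqi : IntervalIntegrable q volume x y := by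
      apply ContinuousOn.intervalIntegrable
      exact hg.continuousOn.div hd.continuousOn (fun t ht => hball t (hsub ht))
    have hEq : ∀ᵐ t, t ∈ uIoc x y → q t = deriv φ t := by
      filter_upwards [hae] with t ht hmem
      have hne := hball t (hsub (uIoc_subset_uIcc hmem))
      simp only [q]
      rw [← ht]
      field_simp
    have hdi : IntervalIntegrable (deriv φ) volume x y := by
      refine hqi.congr_ae ?_
      exact (ae_restrict_iff' measurableSet_uIoc).2 hEq
    have hF := integral_eq_of_hasDerivAt_off_countable φ (deriv φ) hS (a := x) (b := y)
      hφ.continuousOn (fun t ht => (hdiff t ht.2).hasDerivAt) hdi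
    rw [intervalIntegral.integral_congr_ae hEq, hF]
    ring
  have h2 := (hI.const_add (φ x)).congr_of_eventuallyEq hloc.symm
  exact h2.deriv

/-- Behavior of `φ'` at the singular point `ξ = 0` (formula (2.10) of the paper). -/
theorem stmt4 (f D φ : ℝ → ℝ) (α ℓm ℓp c : ℝ)
    (hf : ContDiffOn ℝ 1 f (Icc 0 1)) (hf0 : f 0 = 0)
    (hD : ContDiffOn ℝ 1 D (Icc 0 1))
    (hα : α ∈ Ioo (0:ℝ) 1)
    (hDpos : ∀ ρ ∈ Ioo (0:ℝ) α, 0 < D ρ) (hDneg : ∀ ρ ∈ Ioo α 1, D ρ < 0)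
    (hℓm : ℓm ∈ Ico (0:ℝ) α) (hℓp : ℓp ∈ Ioc α 1)
    (hc1 : c = (f α - f ℓm) / (α - ℓm)) (hc2 : c = (f ℓp - f α) / (ℓp - α))
    (hchord1 : ∀ ρ ∈ Ioo ℓm α, f α + c * (ρ - α) < f ρ)
    (hchord2 : ∀ ρ ∈ Ioo α ℓp, f ρ < f α + c * (ρ - α))
    (hwf : IsWavefront f D c ℓm ℓp φ)
    (hnorm : φ 0 = α ∧ (∀ ξ < (0:ℝ), φ ξ < α) ∧ (∀ ξ > (0:ℝ), α < φ ξ)) :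
    (deriv D α < 0 →
      Tendsto (deriv φ) (𝓝[≠] (0:ℝ)) (𝓝 ((deriv f α - c) / deriv D α))) ∧
    (deriv D α = 0 → deriv f α - c < 0 →
      Tendsto (deriv φ) (𝓝[≠] (0:ℝ)) atTop) := by
  obtain ⟨⟨hφc, hφm, ⟨S, hS, hdiff⟩, hli, hweak⟩, hmono, -, -, -⟩ := hwf
  obtain ⟨h0, hneg, hpos⟩ := hnorm
  have hmono : Monotone φ := by
    rcases hmono with h | h
    · exact h
    · exfalso
      have h1 := hneg (-1) (by norm_num)
      have h2 := hpos 1 (by norm_num)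
      have h3 := h (show (-1:ℝ) ≤ 1 by norm_num)
      linarith
  have hder : ∀ x, 0 ≤ deriv φ x := fun x => hmono.deriv_nonneg
  have hfφ : Continuous (fun x => f (φ x)) := hf.continuousOn.comp_continuous hφc hφm
  have hDφ : Continuous (fun x => D (φ x)) := hD.continuousOn.comp_continuous hφc hφm
  have hcc : Continuous (fun x => - f (φ x) + c * φ x) :=
    hfφ.neg.add (continuous_const.mul hφc)
  obtain ⟨k, hk⟩ := duBoisReymond (fun ξ => D (φ ξ) * deriv φ ξ - f (φ ξ) + c * φ ξ)
    (by
      have := hli.add hcc.locallyIntegrable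
      refine this.congr (ae_of_all _ fun x => ?_)
      simp only [Pi.add_apply]; ring) hweak
  let g : ℝ → ℝ := fun x => f (φ x) - c * φ x + k
  have hgc : Continuous g := (hfφ.sub (continuous_const.mul hφc)).add continuous_const
  have hode : ∀ x, D (φ x) ≠ 0 → deriv φ x = g x / D (φ x) := by
    intro x hx
    refine pointwise_ode φ (fun x => D (φ x)) g hφc hDφ hgc S hS hdiff ?_ x hx
    filter_upwards [hk] with y hy
    simp only [g]; linarith
  have hIcc : Icc (0:ℝ) 1 ∈ 𝓝 α := Icc_mem_nhds hα.1 hα.2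
  have hDα : HasDerivAt D (deriv D α) α :=
    ((hD.contDiffAt hIcc).differentiableAt one_ne_zero).hasDerivAt
  have hfα : HasDerivAt f (deriv f α) α :=
    ((hf.contDiffAt hIcc).differentiableAt one_ne_zero).hasDerivAt
  have hIoo : ∀ᶠ x in 𝓝 (0:ℝ), φ x ∈ Ioo (0:ℝ) 1 := by
    apply hφc.continuousAt.eventually_mem
    rw [h0]
    exact Ioo_mem_nhds hα.1 hα.2
  have hDl : ∀ᶠ x in 𝓝[<] (0:ℝ), 0 < D (φ x) := by
    filter_upwards [hIoo.filter_mono nhdsWithin_le_nhds, self_mem_nhdsWithin] with x hx hx0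
    exact hDpos _ ⟨hx.1, hneg x hx0⟩
  have hDr : ∀ᶠ x in 𝓝[>] (0:ℝ), D (φ x) < 0 := by
    filter_upwards [hIoo.filter_mono nhdsWithin_le_nhds, self_mem_nhdsWithin] with x hx hx0
    exact hDneg _ ⟨hpos x hx0, hx.2⟩
  have hg0l : 0 ≤ g 0 := by
    refine ge_of_tendsto (hgc.continuousAt.tendsto.mono_left nhdsWithin_le_nhds :
      Tendsto g (𝓝[<] (0:ℝ)) (𝓝 (g 0))) ?_
    filter_upwards [hDl] with x hx
    have h1 := hode x hx.ne'
    have h2 := hder x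
    rw [eq_div_iff hx.ne'] at h1
    rw [← h1]; positivity
  have hg0r : g 0 ≤ 0 := by
    refine le_of_tendsto (hgc.continuousAt.tendsto.mono_left nhdsWithin_le_nhds :
      Tendsto g (𝓝[>] (0:ℝ)) (𝓝 (g 0))) ?_
    filter_upwards [hDr] with x hx
    have h1 := hode x hx.ne
    have h2 := hder x
    rw [eq_div_iff hx.ne] at h1
    rw [← h1]; exact mul_nonpos_of_nonneg_of_nonpos h2 hx.le
  have hDl0 : 0 ≤ D (φ 0) :=
    ge_of_tendsto (hDφ.continuousAt.tendsto.mono_left nhdsWithin_le_nhds :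
      Tendsto (fun x => D (φ x)) (𝓝[<] (0:ℝ)) (𝓝 (D (φ 0)))) (hDl.mono fun _ h => h.le)
  have hDr0 : D (φ 0) ≤ 0 :=
    le_of_tendsto (hDφ.continuousAt.tendsto.mono_left nhdsWithin_le_nhds :
      Tendsto (fun x => D (φ x)) (𝓝[>] (0:ℝ)) (𝓝 (D (φ 0)))) (hDr.mono fun _ h => h.le)
  have hD0 : D α = 0 := by rw [← h0]; exact le_antisymm hDr0 hDl0
  have hk0 : k = c * α - f α := by
    have : g 0 = 0 := le_antisymm hg0r hg0l
    simp only [g, h0] at this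
    linarith
  have hφα : Tendsto φ (𝓝[≠] (0:ℝ)) (𝓝[≠] α) := by
    refine tendsto_nhdsWithin_iff.2 ⟨?_, ?_⟩
    · rw [← h0]; exact hφc.continuousAt.tendsto.mono_left nhdsWithin_le_nhds
    · filter_upwards [self_mem_nhdsWithin] with x hx
      rcases lt_or_gt_of_ne hx with h | h
      · exact (hneg x h).ne
      · exact (hpos x h).ne'
  have hnum : Tendsto (fun x => slope f α (φ x) - c) (𝓝[≠] (0:ℝ)) (𝓝 (deriv f α - c)) :=
    (hfα.tendsto_slope.comp hφα).sub_const c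
  have hden : Tendsto (fun x => slope D α (φ x)) (𝓝[≠] (0:ℝ)) (𝓝 (deriv D α)) :=
    hDα.tendsto_slope.comp hφα
  have hsl : ∀ᶠ x in 𝓝[≠] (0:ℝ), slope D α (φ x) < 0 ∧
      deriv φ x = (slope f α (φ x) - c) / slope D α (φ x) := by
    filter_upwards [hIoo.filter_mono nhdsWithin_le_nhds, self_mem_nhdsWithin] with x hx hx0
    have hs : slope D α (φ x) = D (φ x) / (φ x - α) := by rw [slope_def_field, hD0, sub_zero]
    have hDn : D (φ x) ≠ 0 ∧ φ x - α ≠ 0 ∧ slope D α (φ x) < 0 := by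
      rw [hs]
      rcases lt_or_gt_of_ne hx0 with h | h
      · have h1 := hDpos _ ⟨hx.1, hneg x h⟩
        have h2 := sub_neg.2 (hneg x h)
        exact ⟨h1.ne', h2.ne, div_neg_of_pos_of_neg h1 h2⟩
      · have h1 := hDneg _ ⟨hpos x h, hx.2⟩
        have h2 := sub_pos.2 (hpos x h)
        exact ⟨h1.ne, h2.ne', div_neg_of_neg_of_pos h1 h2⟩
    obtain ⟨h1, h2, h3⟩ := hDn
    refine ⟨h3, ?_⟩
    rw [hode x h1, hs, slope_def_field]
    simp only [g, hk0]
    field_simp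
    ring
  constructor
  · intro hlt
    exact (hnum.div hden hlt.ne).congr' (hsl.mono fun x h => h.2.symm)
  · intro hz hlt
    rw [hz] at hden
    have hinv : Tendsto (fun x => (slope D α (φ x))⁻¹) (𝓝[≠] (0:ℝ)) atBot :=
      tendsto_inv_nhdsLT_zero.comp
        (tendsto_nhdsWithin_iff.2 ⟨hden, hsl.mono fun x h => h.1⟩)
    have := hnum.neg_mul_atBot hlt hinv
    refine this.congr' (hsl.mono fun x h => ?_)
    rw [h.2, div_eq_mul_inv]
end

section
/- Assume (f) and (D1) with threshold α ∈ (0,1), and let φ be a traveling-wave profile of ρ_t + f(ρ)_x = (D(ρ)ρ_x)_x with speed c, defined on an open interval I. If I₊ ⊆ I is an open interval on which D(φ(ξ)) > 0 for all ξ ∈ I₊, or on which D(φ(ξ)) < 0 for all ξ ∈ I₊, then φ is twice continuously differentiable on I₊ and the function ξ ↦ D(φ(ξ))φ′(ξ) + cφ(ξ) − f(φ(ξ)) is constant on I₊. -/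
open Set Filter MeasureTheory Topology

/-- A traveling-wave profile of `ρ_t + f(ρ)_x = (D(ρ)ρ_x)_x` with speed `c`,
defined on the open interval `I`: continuous on `I`, valued in `[0,1]` on `I`,
differentiable off a countable set, with `D(φ)φ'` locally integrable on `I`,
and satisfying the weak form of the profile ODE against test functions
supported in `I`. -/
def IsTWProfileOn (f D : ℝ → ℝ) (c : ℝ) (φ : ℝ → ℝ) (I : Set ℝ) : Prop :=
  ContinuousOn φ I ∧ (∀ ξ ∈ I, φ ξ ∈ Icc (0:ℝ) 1) ∧
  (∃ S : Set ℝ, S.Countable ∧ ∀ ξ ∈ I \ S, DifferentiableAt ℝ φ ξ) ∧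
  LocallyIntegrableOn (fun ξ => D (φ ξ) * deriv φ ξ) I ∧
  ∀ ψ : ℝ → ℝ, ContDiff ℝ (⊤ : ℕ∞) ψ → HasCompactSupport ψ → tsupport ψ ⊆ I →
    ∫ ξ in I, (D (φ ξ) * deriv φ ξ - f (φ ξ) + c * φ ξ) * deriv ψ ξ = 0

/-- Primitive of a mean-zero test function is a test function. -/
lemma exists_test_primitive (U : Set ℝ) (hUc : U.OrdConnected) (η : ℝ → ℝ)
    (hη : ContDiff ℝ (⊤ : ℕ∞) η) (hηc : HasCompactSupport η) (hηU : tsupport η ⊆ U)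
    (h0 : ∫ x, η x = 0) :
    ∃ ψ : ℝ → ℝ, ContDiff ℝ (⊤ : ℕ∞) ψ ∧ HasCompactSupport ψ ∧ tsupport ψ ⊆ U ∧
      deriv ψ = η := by
  have hint : Integrable η := hη.continuous.integrable_of_hasCompactSupport hηc
  rcases (tsupport η).eq_empty_or_nonempty with he | hne
  · have : η = 0 := tsupport_eq_empty_iff.1 he
    refine ⟨0, contDiff_const, HasCompactSupport.zero, by simp [tsupport], ?_⟩
    rw [this]; ext x; simp
  obtain ⟨a, haS, ha⟩ := hηc.isCompact.exists_isLeast hne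
  obtain ⟨b, hbS, hb⟩ := hηc.isCompact.exists_isGreatest hne
  have hderiv : ∀ x, HasDerivAt (fun x => ∫ t in Iic x, η t) (η x) x := by
    intro x
    have h1 : (fun x => ∫ t in Iic x, η t) = fun x => (∫ t in Iic (0:ℝ), η t) + ∫ t in (0:ℝ)..x, η t := by
      ext y
      rw [← intervalIntegral.integral_Iic_sub_Iic hint.integrableOn hint.integrableOn]
      ring
    rw [h1]
    exact ((hη.continuous.integral_hasStrictDerivAt 0 x).hasDerivAt).const_add _
  have hde : deriv (fun x => ∫ t in Iic x, η t) = η := funext fun x => (hderiv x).deriv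
  have hsupp : tsupport (fun x => ∫ t in Iic x, η t) ⊆ Icc a b := by
    refine closure_minimal ?_ isClosed_Icc
    intro x hx
    by_contra hcon
    apply hx
    rw [mem_Icc, not_and_or, not_le, not_le] at hcon
    rcases hcon with h | h
    · refine setIntegral_eq_zero_of_forall_eq_zero ?_
      intro t ht
      refine image_eq_zero_of_notMem_tsupport fun htS => ?_
      exact absurd (ha htS) (not_le.2 (lt_of_le_of_lt ht h))
    · show ∫ t in Iic x, η t = 0
      rw [setIntegral_eq_integral_of_forall_compl_eq_zero, h0]
      intro t ht
      refine image_eq_zero_of_notMem_tsupport fun htS => ?_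
      exact ht ((hb htS).trans h.le)
  refine ⟨fun x => ∫ t in Iic x, η t, ?_, ?_, ?_, hde⟩
  · refine contDiff_infty_iff_deriv.2 ⟨fun x => (hderiv x).differentiableAt, ?_⟩
    rw [hde]; exact hη
  · exact isCompact_Icc.of_isClosed_subset (isClosed_tsupport _) hsupp
  · exact hsupp.trans (hUc.out (hηU haS) (hηU hbS))

/-- Products of locally integrable functions with test functions are integrable. -/
lemma integrable_mul_test (U : Set ℝ) (h : ℝ → ℝ) (hh : LocallyIntegrableOn h U) (ψ : ℝ → ℝ)
    (hψ : Continuous ψ) (hψc : HasCompactSupport ψ) (hψU : tsupport ψ ⊆ U) :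
    Integrable (fun x => h x * ψ x) := by
  have h1 : IntegrableOn (fun x => h x * ψ x) (tsupport ψ) :=
    (hh.integrableOn_compact_subset hψU hψc).mul_continuousOn hψ.continuousOn hψc
  refine (integrableOn_iff_integrable_of_support_subset ?_).1 h1
  intro x hx
  refine subset_tsupport _ ?_
  intro h0
  apply hx
  simp [h0]

/-- du Bois-Reymond lemma on an open interval. -/
lemma du_bois_reymond (U : Set ℝ) (hU : IsOpen U) (hUc : U.OrdConnected) (hne : U.Nonempty)
    (h : ℝ → ℝ) (hh : LocallyIntegrableOn h U)
    (hw : ∀ ψ : ℝ → ℝ, ContDiff ℝ (⊤ : ℕ∞) ψ → HasCompactSupport ψ → tsupport ψ ⊆ U →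
      ∫ x, h x * deriv ψ x = 0) :
    ∃ k : ℝ, ∀ᵐ x, x ∈ U → h x = k := by
  obtain ⟨x0, hx0⟩ := hne
  obtain ⟨χ, χU, χc, χs, χr, χ1⟩ :=
    exists_contDiff_tsupport_subset (n := ⊤) (hU.mem_nhds hx0)
  have hm : 0 < ∫ x, χ x :=
    χs.continuous.integral_pos_of_hasCompactSupport_nonneg_nonzero χc
      (fun x => (χr (mem_range_self x)).1) (x := x0) (by rw [χ1]; exact one_ne_zero)
  set m := ∫ x, χ x with hmdef
  refine ⟨(∫ x, h x * χ x) / m, ?_⟩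
  set k := (∫ x, h x * χ x) / m with hk
  have key := hU.ae_eq_zero_of_integral_contDiff_smul_eq_zero (μ := volume)
    (f := fun x => h x - k)
    (hh.sub (continuousOn_const.locallyIntegrableOn hU.measurableSet)) ?_
  · filter_upwards [key] with x hx hxU
    exact sub_eq_zero.1 (hx hxU)
  intro g hg hgc hgU
  set r := (∫ x, g x) / m with hr
  have ig : Integrable g := hg.continuous.integrable_of_hasCompactSupport hgc
  have iχ : Integrable χ := χs.continuous.integrable_of_hasCompactSupport χc
  have hsub : tsupport (fun x => g x - r * χ x) ⊆ tsupport g ∪ tsupport χ := by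
    refine closure_minimal ?_ ((isClosed_tsupport _).union (isClosed_tsupport _))
    intro x hx
    by_contra hcon
    rw [mem_union, not_or] at hcon
    apply hx
    simp [image_eq_zero_of_notMem_tsupport hcon.1, image_eq_zero_of_notMem_tsupport hcon.2]
  obtain ⟨ψ, ψs, ψc, ψU, ψd⟩ := exists_test_primitive U hUc (fun x => g x - r * χ x)
    (hg.sub (contDiff_const.mul χs))
    ((hgc.isCompact.union χc.isCompact).of_isClosed_subset (isClosed_tsupport _) hsub)
    (hsub.trans (union_subset hgU χU))
    (by
      rw [integral_sub ig (iχ.const_mul r), integral_const_mul, ← hmdef, hr]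
      field_simp
      ring)
  have h1 := hw ψ ψs ψc ψU
  have ihg := integrable_mul_test U h hh g hg.continuous hgc hgU
  have ihχ := integrable_mul_test U h hh χ χs.continuous χc χU
  rw [ψd] at h1
  have e1 : ∀ x, h x * (g x - r * χ x) = h x * g x - r * (h x * χ x) := fun x => by ring
  simp_rw [e1] at h1
  rw [integral_sub ihg (ihχ.const_mul r), integral_const_mul] at h1
  have e2 : ∀ x, g x • (h x - k) = h x * g x - k * g x := fun x => by
    rw [smul_eq_mul]; ring
  simp_rw [e2]
  rw [integral_sub ihg (ig.const_mul k), integral_const_mul, ← h1, hr, hk]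
  field_simp

/-- Remark 2.2: on any subinterval where `D(φ)` has a constant (nonzero) sign,
the profile is classical, of class `C²`, and the first integral
`D(φ)φ' + cφ - f(φ)` is constant. -/
theorem stmt13 (f D : ℝ → ℝ) (α : ℝ)
    (hf : ContDiffOn ℝ 1 f (Icc 0 1)) (hf0 : f 0 = 0)
    (hD : ContDiffOn ℝ 1 D (Icc 0 1))
    (hα : α ∈ Ioo (0:ℝ) 1)
    (hDpos : ∀ ρ ∈ Ioo (0:ℝ) α, 0 < D ρ) (hDneg : ∀ ρ ∈ Ioo α 1, D ρ < 0)
    (c : ℝ) (φ : ℝ → ℝ) (I : Set ℝ) (hI : IsOpen I) (hI' : I.OrdConnected)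
    (hφ : IsTWProfileOn f D c φ I)
    (Ip : Set ℝ) (hIp : IsOpen Ip) (hIp' : Ip.OrdConnected) (hIpI : Ip ⊆ I)
    (hsign : (∀ ξ ∈ Ip, 0 < D (φ ξ)) ∨ (∀ ξ ∈ Ip, D (φ ξ) < 0)) :
    ContDiffOn ℝ 2 φ Ip ∧
    ∃ k : ℝ, ∀ ξ ∈ Ip, D (φ ξ) * deriv φ ξ + c * φ ξ - f (φ ξ) = k := by
  rcases Ip.eq_empty_or_nonempty with rfl | hne
  · exact ⟨contDiffOn_empty, 0, by simp⟩
  obtain ⟨hc, hr, ⟨S, hS, hSd⟩, hli, hw⟩ := hφ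
  have hcp : ContinuousOn φ Ip := hc.mono hIpI
  have hmaps : MapsTo φ Ip (Icc 0 1) := fun x hx => hr x (hIpI hx)
  have hD0 : ∀ ξ ∈ Ip, D (φ ξ) ≠ 0 := by
    intro ξ hξ
    rcases hsign with h | h
    · exact (h ξ hξ).ne'
    · exact (h ξ hξ).ne
  have hfc : ContinuousOn (fun ξ => f (φ ξ)) Ip := hf.continuousOn.comp hcp hmaps
  have hDc : ContinuousOn (fun ξ => D (φ ξ)) Ip := hD.continuousOn.comp hcp hmaps
  obtain ⟨k, hk⟩ := du_bois_reymond Ip hIp hIp' hne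
    (fun ξ => D (φ ξ) * deriv φ ξ - f (φ ξ) + c * φ ξ)
    (((hli.mono_set hIpI).sub (hfc.locallyIntegrableOn hIp.measurableSet)).add
      ((continuousOn_const.mul hcp).locallyIntegrableOn hIp.measurableSet))
    (by
      intro ψ h1 h2 h3
      rw [← hw ψ h1 h2 (h3.trans hIpI)]
      symm
      apply setIntegral_eq_integral_of_forall_compl_eq_zero
      intro x hx
      have : deriv ψ x = 0 := by
        by_contra hcon
        exact hx (hIpI (h3 (support_deriv_subset hcon)))
      rw [this, mul_zero])
  set g : ℝ → ℝ := fun ξ => (k + f (φ ξ) - c * φ ξ) / D (φ ξ) with hg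
  have hgc : ContinuousOn g Ip :=
    ((continuousOn_const.add hfc).sub (continuousOn_const.mul hcp)).div hDc hD0
  have hae : ∀ᵐ x, x ∈ Ip → deriv φ x = g x := by
    filter_upwards [hk] with x hx hxI
    have := hx hxI
    rw [hg, eq_div_iff (hD0 x hxI)]
    linarith
  obtain ⟨x0, hx0⟩ := hne
  have hgi : ∀ x ∈ Ip, IntervalIntegrable g volume x0 x := fun x hx =>
    (hgc.mono (hIp'.uIcc_subset hx0 hx)).intervalIntegrable
  have hFTC : ∀ x ∈ Ip, φ x = φ x0 + ∫ t in x0..x, g t := by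
    intro x hx
    have hsub : uIcc x0 x ⊆ Ip := hIp'.uIcc_subset hx0 hx
    have hae' : ∀ᵐ t, t ∈ uIoc x0 x → deriv φ t = g t := by
      filter_upwards [hae] with t ht htI
      exact ht (hsub (uIoc_subset_uIcc htI))
    have hi : IntervalIntegrable (deriv φ) volume x0 x := by
      refine (hgi x hx).congr_ae ?_
      rw [Filter.EventuallyEq, ae_restrict_iff' measurableSet_uIoc]
      filter_upwards [hae'] with t ht htI using (ht htI).symm
    have h1 := integral_eq_of_hasDerivAt_off_countable φ (deriv φ) hS (hcp.mono hsub)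
      (fun t ht => (hSd t ⟨hIpI (hsub (Ioo_subset_Icc_self ht.1)), ht.2⟩).hasDerivAt) hi
    rw [intervalIntegral.integral_congr_ae hae'] at h1
    linarith
  have hder : ∀ x ∈ Ip, HasDerivAt φ (g x) x := by
    intro x hx
    have h1 : HasDerivAt (fun y => φ x0 + ∫ t in x0..y, g t) (g x) x :=
      (intervalIntegral.integral_hasDerivAt_right (hgi x hx)
        (hgc.stronglyMeasurableAtFilter hIp x hx)
        (hgc.continuousAt (hIp.mem_nhds hx))).const_add _
    refine h1.congr_of_eventuallyEq ?_
    filter_upwards [hIp.mem_nhds hx] with y hy using hFTC y hy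
  have hdd : DifferentiableOn ℝ φ Ip := fun x hx =>
    (hder x hx).differentiableAt.differentiableWithinAt
  have hC1 : ContDiffOn ℝ 1 φ Ip := by
    rw [show (1 : WithTop ℕ∞) = 0 + 1 from rfl, contDiffOn_succ_iff_deriv_of_isOpen hIp]
    refine ⟨hdd, by simp, ?_⟩
    rw [contDiffOn_zero]
    exact hgc.congr fun x hx => (hder x hx).deriv
  have hg1 : ContDiffOn ℝ 1 g Ip :=
    ((contDiffOn_const.add (hf.comp hC1 hmaps)).sub (contDiffOn_const.mul hC1)).div
      (hD.comp hC1 hmaps) hD0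
  refine ⟨?_, k, ?_⟩
  · rw [show (2 : WithTop ℕ∞) = 1 + 1 from one_add_one_eq_two.symm,
      contDiffOn_succ_iff_deriv_of_isOpen hIp]
    exact ⟨hdd, by simp, hg1.congr fun x hx => (hder x hx).deriv⟩
  · intro ξ hξ
    rw [(hder ξ hξ).deriv, hg]
    have := hD0 ξ hξ
    field_simp
    ring
end
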